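/- Suppose S is a primitive sequence with curling number k > 1 which is not robust. Then the representation S = X(TX)^k with T a proper suffix of S is unique: if S = X(TX)^k = X'(T'X')^k where both T and T' are proper suffixes of S, then X = X' and T = T'. -/

import Mathlib

/-- `listPow Y k` is the sequence `Y` repeated `k` times (i.e. `Y^k`). -/
def listPow {α : Type*} (Y : List α) : ℕ → List α
  | 0 => []
  | k + 1 => Y ++ listPow Y k

/-- The curling number of a finite sequence `S`: the largest `k` such that
`S = X ++ Y^k` for some (possibly empty) `X` and nonempty `Y`. -/
noncomputable def CN {α : Type*} (S : List α) : ℕ :=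
  sSup {k | ∃ X Y : List α, Y ≠ [] ∧ S = X ++ listPow Y k}

/-- A nonempty sequence is primitive if it is not a power `T^i` with `i ≥ 2`. -/
def Primitive {α : Type*} (S : List α) : Prop :=
  S ≠ [] ∧ ∀ (T : List α) (i : ℕ), 2 ≤ i → S ≠ listPow T i

/-- `T` is a proper suffix of `S`: a suffix which is strictly shorter than `S`. -/
def ProperSuffix {α : Type*} (T S : List α) : Prop := T <:+ S ∧ T.length < S.length

/-- A sequence `S` with curling number `k` is robust if no proper suffix of
`S^(k+1)` has curling number `≥ k + 1`. -/
def Robust {α : Type*} (S : List α) : Prop :=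
  ∀ T : List α, ProperSuffix T (listPow S (CN S + 1)) → CN T ≤ CN S

theorem length_listPow {α : Type*} (Y : List α) (n : ℕ) :
    (listPow Y n).length = n * Y.length := by
  induction n with
  | zero => simp [listPow]
  | succ n ih => simp only [listPow, List.length_append, ih]; ring

theorem listPow_prefix_succ {α : Type*} (Y : List α) (n : ℕ) :
    listPow Y n <+: listPow Y (n + 1) := by
  induction n with
  | zero => simp [listPow]
  | succ n ih => exact (List.prefix_append_right_inj Y).mpr ih

theorem hasPeriod_listPow {α : Type*} (Y : List α) (n : ℕ) :
    (listPow Y n).HasPeriod Y.length := by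
  cases n with
  | zero => simp [listPow]
  | succ n =>
    simp only [List.HasPeriod, listPow, List.take_left]
    exact (List.prefix_append_right_inj Y).mpr (listPow_prefix_succ Y n)

theorem hasPeriod_append_listPow {α : Type*} (X T : List α) (n : ℕ) :
    (X ++ listPow (T ++ X) n).HasPeriod (T ++ X).length :=
  (hasPeriod_listPow (T ++ X) (n + 1)).infix <|
    List.IsSuffix.isInfix ⟨T, by simp [listPow]⟩

theorem List.HasPeriod.eq_listPow {α : Type*} {g : ℕ} (m : ℕ) {L : List α}
    (h : L.HasPeriod g) (hL : L.length = m * g) : L = listPow (L.take g) m := by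
  induction m generalizing L with
  | zero => simpa [listPow] using hL
  | succ m ih =>
    have hlen : (L.drop g).length = m * g := by
      rw [List.length_drop, hL, Nat.succ_mul, Nat.add_sub_cancel]
    have hdrop := ih (h.infix (List.drop_suffix g L).isInfix) hlen
    have htake : listPow ((L.drop g).take g) m = listPow (L.take g) m := by
      cases m with
      | zero => rfl
      | succ m =>
        have hg : g ≤ (L.drop g).length := by
          rw [hlen]; exact Nat.le_mul_of_pos_left g m.succ_pos
        obtain ⟨r, hr⟩ := h.drop_prefix g
        have : L.take g = (L.drop g).take g := by
          conv_lhs => rw [← hr]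
          exact List.take_append_of_le_length hg
        rw [this]
    rw [htake] at hdrop
    rw [listPow, ← hdrop, List.take_append_drop]

theorem le_CN {α : Type*} {X Y : List α} {m : ℕ} (hY : Y ≠ []) :
    m ≤ CN (X ++ listPow Y m) := by
  refine le_csSup ⟨(X ++ listPow Y m).length, ?_⟩ ⟨X, Y, hY, rfl⟩
  rintro j ⟨X', Y', hY', h⟩
  rw [h, List.length_append, length_listPow]
  exact (Nat.le_mul_of_pos_right j (List.length_pos_iff.mpr hY')).trans (Nat.le_add_left _ _)

theorem List.HasPeriod.le_CN {α : Type*} {S : List α} {g m : ℕ} (h : S.HasPeriod g)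
    (hg : 0 < g) (hm : m * g ≤ S.length) : m ≤ CN S := by
  rcases Nat.eq_zero_or_pos m with rfl | hm0
  · exact Nat.zero_le _
  have hlen : (S.drop (S.length - m * g)).length = m * g := by
    rw [List.length_drop]; omega
  have hpow := (h.infix (List.drop_suffix (S.length - m * g) S).isInfix).eq_listPow m hlen
  have hne : (S.drop (S.length - m * g)).take g ≠ [] := by
    rw [← List.length_pos_iff, List.length_take, hlen]
    exact lt_min hg (Nat.mul_pos hm0 hg)
  have hS : S.take (S.length - m * g) ++
      listPow ((S.drop (S.length - m * g)).take g) m = S := by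
    rw [← hpow, List.take_append_drop]
  have := _root_.le_CN (X := S.take (S.length - m * g)) (m := m) hne
  rwa [hS] at this

/-- If a shorter period divides a period `p` with `CN S * p ≤ S.length`, it equals `p`. -/
theorem List.HasPeriod.eq_of_dvd {α : Type*} {S : List α} {g p : ℕ} (h : S.HasPeriod g)
    (hp : 0 < p) (hgp : g ∣ p) (hk : 0 < CN S) (hlen : CN S * p ≤ S.length) : g = p := by
  obtain ⟨c, rfl⟩ := hgp
  have hg := Nat.pos_of_mul_pos_right hp
  have hc : CN S * c ≤ CN S := h.le_CN hg (by rwa [Nat.mul_assoc, Nat.mul_comm c])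
  have : c ≤ 1 := Nat.le_of_mul_le_mul_left (by simpa using hc) hk
  have : c ≠ 0 := by rintro rfl; simp at hp
  obtain rfl : c = 1 := by omega
  simp

/-- For a primitive non-robust `S` with curling number `k > 1`, the representation
`S = X (T X)^k` with `T` a proper suffix of `S` is unique. -/
theorem thSick3 {α : Type*} (S : List α) (k : ℕ) (hP : Primitive S) (hk : CN S = k)
    (hk1 : 1 < k) (hR : ¬ Robust S)
    (X T X' T' : List α)
    (h1 : S = X ++ listPow (T ++ X) k) (h2 : ProperSuffix T S)
    (h3 : S = X' ++ listPow (T' ++ X') k) (h4 : ProperSuffix T' S) :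
    X = X' ∧ T = T' := by
  subst hk
  have pos : ∀ U V : List α, S = U ++ listPow (V ++ U) (CN S) → 0 < (V ++ U).length := by
    intro U V h
    rw [List.length_pos_iff]
    intro h0
    obtain ⟨rfl, rfl⟩ := List.append_eq_nil_iff.mp h0
    apply hP.1
    rw [← List.length_eq_zero_iff, h, List.length_append, length_listPow]
    simp
  have per : ∀ U V : List α, S = U ++ listPow (V ++ U) (CN S) →
      S.HasPeriod (V ++ U).length := by
    intro U V h
    have := hasPeriod_append_listPow U V (CN S)
    rwa [← h] at this
  have len : ∀ U V : List α, S = U ++ listPow (V ++ U) (CN S) →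
      S.length = U.length + CN S * (V ++ U).length := by
    intro U V h
    have := congrArg List.length h
    rwa [List.length_append, length_listPow] at this
  have l1 := len X T h1
  have l3 := len X' T' h3
  have hsum : (T ++ X).length + (T' ++ X').length ≤ S.length := by
    have := Nat.mul_le_mul_right (T ++ X).length hk1
    have := Nat.mul_le_mul_right (T' ++ X').length hk1
    omega
  have hgcd := (per X T h1).gcd (per X' T' h3) ((Nat.sub_le _ _).trans hsum)
  have e1 := hgcd.eq_of_dvd (pos X T h1) (Nat.gcd_dvd_left _ _) (by omega) (by omega)
  have e3 := hgcd.eq_of_dvd (pos X' T' h3) (Nat.gcd_dvd_right _ _) (by omega) (by omega)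
  have hp : (T ++ X).length = (T' ++ X').length := e1.symm.trans e3
  have hX : X.length = X'.length := by
    rw [hp] at l1
    omega
  obtain ⟨rfl, hpow⟩ := List.append_inj (h1.symm.trans h3) hX
  obtain ⟨n, hn⟩ : ∃ n, CN S = n + 1 := ⟨CN S - 1, by omega⟩
  rw [hn, listPow, listPow] at hpow
  exact ⟨rfl, List.append_cancel_right (List.append_inj_left hpow hp)⟩
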